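/- Let {X_n, n≥1} be a φ-mixing sequence of random variables with mixing coefficients satisfying φ(n)=O(n^{-3}), and assume P(X_i = X_j) = 0 for all i ≠ j. Fix p ∈ (0,1) and assume the common marginal distribution function F possesses a positive continuous density f in a neighborhood N_p of ξ_p such that 0 < sup{f(x) : x ∈ N_p} < ∞, and that f′(x) is bounded in N_p. Then with probability 1, ξ_{p,n} = ξ_p − (F_n(ξ_p) − p)/f(ξ_p) + O(n^{-3/4} log n) as n → ∞. -/

import Mathlib

open MeasureTheory Filter Set

/-- The σ-algebra generated by the random variables `X i` for `i ∈ S`. -/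
noncomputable def sigmaGen {Ω : Type*} (X : ℕ → Ω → ℝ) (S : Set ℕ) : MeasurableSpace Ω :=
  ⨆ i ∈ S, MeasurableSpace.comap (X i) inferInstance

/-- The φ-mixing coefficients of the sequence `X` with respect to the measure `μ`:
`φ(n) = sup_{k ≥ 1} sup { |P(B|A) - P(B)| : A ∈ σ(X_i, 1 ≤ i ≤ k), P(A) > 0,
B ∈ σ(X_i, i ≥ k + n) }`. -/
noncomputable def phiCoef {Ω : Type*} [MeasurableSpace Ω] (X : ℕ → Ω → ℝ)
    (μ : Measure Ω) (n : ℕ) : ℝ :=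
  sSup {r : ℝ | ∃ k : ℕ, 1 ≤ k ∧ ∃ A B : Set Ω,
    MeasurableSet[sigmaGen X {i | 1 ≤ i ∧ i ≤ k}] A ∧
    MeasurableSet[sigmaGen X {i | k + n ≤ i}] B ∧
    0 < μ A ∧
    r = |(μ (A ∩ B)).toReal / (μ A).toReal - (μ B).toReal|}

/-- The empirical distribution function `F_n(x) = n⁻¹ ∑_{i=1}^n I(X_i ≤ x)`. -/
noncomputable def empDF {Ω : Type*} (X : ℕ → Ω → ℝ) (n : ℕ) (ω : Ω) (x : ℝ) : ℝ :=
  (n : ℝ)⁻¹ * ∑ i ∈ Finset.Icc 1 n, (if X i ω ≤ x then (1 : ℝ) else 0)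

/-- The `p`-th quantile `F⁻¹(p) = inf {x : F(x) ≥ p}` of a distribution function `F`. -/
noncomputable def quantile (F : ℝ → ℝ) (p : ℝ) : ℝ :=
  sInf {x : ℝ | p ≤ F x}

/-- The sample `p`-th quantile `ξ_{p,n} = F_n⁻¹(p) = inf {x : F_n(x) ≥ p}`. -/
noncomputable def sampleQuantile {Ω : Type*} (X : ℕ → Ω → ℝ) (n : ℕ) (ω : Ω) (p : ℝ) : ℝ :=
  sInf {x : ℝ | p ≤ empDF X n ω x}

section Mixing

variable {Ω : Type*}

theorem measurable_sigmaGen {X : ℕ → Ω → ℝ} {S : Set ℕ} {i : ℕ} (hi : i ∈ S) :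
    Measurable[sigmaGen X S] (X i) := by
  rw [measurable_iff_comap_le]
  exact le_iSup₂_of_le i hi le_rfl

theorem sigmaGen_le [m0 : MeasurableSpace Ω] {X : ℕ → Ω → ℝ} (hX : ∀ i, Measurable (X i))
    (S : Set ℕ) : sigmaGen X S ≤ m0 :=
  iSup₂_le fun i _ => (hX i).comap_le

theorem phiCoef_nonneg [MeasurableSpace Ω] {μ : Measure Ω} {X : ℕ → Ω → ℝ} (n : ℕ) : 0 ≤ phiCoef X μ n := by
  refine Real.sSup_nonneg ?_
  rintro r ⟨k, -, A, B, -, -, -, rfl⟩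
  exact abs_nonneg _

/-- The indicator of `X i ∈ B`, centered at `q`. -/
noncomputable def centeredInd {Ω : Type*} (X : ℕ → Ω → ℝ) (B : Set ℝ) (q : ℝ) (i : ℕ) (ω : Ω) : ℝ :=
  (X i ⁻¹' B).indicator (fun _ => (1 : ℝ)) ω - q

variable {X : ℕ → Ω → ℝ} {B : Set ℝ} {q : ℝ}

theorem measurable_sum_centeredInd {S : Set ℕ} {I : Finset ℕ} (hI : ∀ i ∈ I, i ∈ S)
    (hB : MeasurableSet B) :
    Measurable[sigmaGen X S] fun ω => ∑ i ∈ I, centeredInd X B q i ω := by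
  refine Finset.measurable_fun_sum I fun i hi => ?_
  have h : MeasurableSet[sigmaGen X S] (X i ⁻¹' B) := measurable_sigmaGen (hI i hi) hB
  exact (measurable_const.indicator h).sub measurable_const

theorem abs_centeredInd_le (hq0 : 0 ≤ q) (hq1 : q ≤ 1) (i : ℕ) (ω : Ω) :
    |centeredInd X B q i ω| ≤ 1 := by
  unfold centeredInd
  by_cases h : ω ∈ X i ⁻¹' B
  · rw [indicator_of_mem h, abs_le]; constructor <;> linarith
  · rw [indicator_of_notMem h, abs_le]; constructor <;> linarith

theorem abs_sum_centeredInd_le (hq0 : 0 ≤ q) (hq1 : q ≤ 1) (I : Finset ℕ) (ω : Ω) :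
    |∑ i ∈ I, centeredInd X B q i ω| ≤ I.card := by
  refine (Finset.abs_sum_le_sum_abs _ _).trans ?_
  refine (Finset.sum_le_card_nsmul _ _ 1 fun i _ => abs_centeredInd_le hq0 hq1 i ω).trans ?_
  simp

theorem exp_mul_sum_centeredInd_le (hq0 : 0 ≤ q) (hq1 : q ≤ 1) (I : Finset ℕ) (t : ℝ) (ω : Ω) :
    Real.exp (t * ∑ i ∈ I, centeredInd X B q i ω) ≤ Real.exp (|t| * I.card) := by
  refine Real.exp_le_exp.2 ((le_abs_self _).trans ?_)
  rw [abs_mul]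
  exact mul_le_mul_of_nonneg_left (abs_sum_centeredInd_le hq0 hq1 I ω) (abs_nonneg t)

variable [MeasurableSpace Ω] {μ : Measure Ω} [IsProbabilityMeasure μ]

theorem abs_measureReal_inter_sub_le {k n : ℕ} (hk : 1 ≤ k) {A B : Set Ω}
    (hA : MeasurableSet[sigmaGen X {i | 1 ≤ i ∧ i ≤ k}] A)
    (hB : MeasurableSet[sigmaGen X {i | k + n ≤ i}] B) :
    |μ.real (A ∩ B) - μ.real A * μ.real B| ≤ phiCoef X μ n * μ.real A := by
  rcases eq_or_ne (μ A) 0 with h0 | h0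
  · have h1 : μ (A ∩ B) = 0 := measure_mono_null inter_subset_left h0
    simp [Measure.real, h0, h1]
  have hpos : 0 < μ.real A := ENNReal.toReal_pos h0 (measure_ne_top _ _)
  have hle : |μ.real (A ∩ B) / μ.real A - μ.real B| ≤ phiCoef X μ n := by
    refine le_csSup ⟨1, ?_⟩ ⟨k, hk, A, B, hA, hB, pos_iff_ne_zero.2 h0, rfl⟩
    rintro r ⟨k, -, A, B, -, -, hA0, rfl⟩
    have h1 : μ.real (A ∩ B) / μ.real A ≤ 1 :=
      div_le_one_of_le₀ (measureReal_mono inter_subset_left) measureReal_nonneg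
    have h2 : 0 ≤ μ.real (A ∩ B) / μ.real A := div_nonneg measureReal_nonneg measureReal_nonneg
    have h3 : μ.real B ≤ 1 := measureReal_le_one
    have h4 : 0 ≤ μ.real B := measureReal_nonneg
    simp only [Measure.real] at h1 h2 h3 h4
    rw [abs_le]
    constructor <;> linarith
  have : μ.real (A ∩ B) - μ.real A * μ.real B
      = (μ.real (A ∩ B) / μ.real A - μ.real B) * μ.real A := by
    field_simp
  rw [this, abs_mul, abs_of_pos hpos]
  gcongr

theorem setLIntegral_le_of_mixing (hX : ∀ i, Measurable (X i)) {k n : ℕ} (hk : 1 ≤ k)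
    {Z : Ω → ENNReal} (hZ : Measurable[sigmaGen X {i | 1 ≤ i ∧ i ≤ k}] Z) {B : Set Ω}
    (hB : MeasurableSet[sigmaGen X {i | k + n ≤ i}] B) :
    ∫⁻ ω in B, Z ω ∂μ ≤ (μ B + ENNReal.ofReal (phiCoef X μ n)) * ∫⁻ ω, Z ω ∂μ := by
  have hm := sigmaGen_le hX {i | 1 ≤ i ∧ i ≤ k}
  rw [← lintegral_trim hm hZ, ← lintegral_trim hm hZ, ← smul_eq_mul, ← lintegral_smul_measure]
  refine lintegral_mono' ?_ le_rfl
  rw [Measure.le_iff]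
  intro A hA
  rw [Measure.smul_apply, trim_measurableSet_eq hm hA, trim_measurableSet_eq hm hA,
    Measure.restrict_apply (hm _ hA), smul_eq_mul]
  have h := abs_measureReal_inter_sub_le (μ := μ) hk hA hB
  rw [← ENNReal.ofReal_toReal (measure_ne_top μ (A ∩ B)),
    ← ENNReal.ofReal_toReal (measure_ne_top μ A), ← ENNReal.ofReal_toReal (measure_ne_top μ B),
    ← ENNReal.ofReal_add ENNReal.toReal_nonneg (phiCoef_nonneg n),
    ← ENNReal.ofReal_mul (add_nonneg ENNReal.toReal_nonneg (phiCoef_nonneg n))]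
  refine ENNReal.ofReal_le_ofReal ?_
  simp only [Measure.real] at h
  linarith [(abs_le.1 h).2]

theorem lintegral_mul_le_of_mixing (hX : ∀ i, Measurable (X i)) {k n : ℕ} (hk : 1 ≤ k)
    {Z : Ω → ENNReal} (hZ : Measurable[sigmaGen X {i | 1 ≤ i ∧ i ≤ k}] Z) {W : Ω → ℝ}
    (hW : Measurable[sigmaGen X {i | k + n ≤ i}] W) {K : ℝ} (hW0 : ∀ ω, 0 ≤ W ω)
    (hWK : ∀ ω, W ω ≤ K) :
    ∫⁻ ω, Z ω * ENNReal.ofReal (W ω) ∂μ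
      ≤ (∫⁻ ω, Z ω ∂μ) * (∫⁻ ω, ENNReal.ofReal (W ω) ∂μ
        + ENNReal.ofReal K * ENNReal.ofReal (phiCoef X μ n)) := by
  have hZm : Measurable Z := hZ.mono (sigmaGen_le hX _) le_rfl
  have hWm : Measurable W := hW.mono (sigmaGen_le hX _) le_rfl
  have hset : ∀ t, MeasurableSet[sigmaGen X {i | k + n ≤ i}] {ω | t < W ω} := fun t =>
    hW measurableSet_Ioi
  have h1 : ∫⁻ ω, Z ω * ENNReal.ofReal (W ω) ∂μ
      = ∫⁻ t in Ioi (0 : ℝ), ∫⁻ ω in {ω | t < W ω}, Z ω ∂μ := by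
    have := lintegral_withDensity_eq_lintegral_mul μ hZm hWm.ennreal_ofReal
    simp only [Pi.mul_apply] at this
    rw [← this, lintegral_eq_lintegral_meas_lt _ (ae_of_all _ hW0) hWm.aemeasurable]
    refine lintegral_congr fun t => ?_
    rw [withDensity_apply _ (sigmaGen_le hX _ _ (hset t))]
  have hanti : Antitone fun t : ℝ => μ {ω | t < W ω} := fun s t hst =>
    measure_mono fun ω (h : t < W ω) => lt_of_le_of_lt hst h
  rw [h1, lintegral_eq_lintegral_meas_lt μ (ae_of_all _ hW0) hWm.aemeasurable]
  calc ∫⁻ t in Ioi (0 : ℝ), ∫⁻ ω in {ω | t < W ω}, Z ω ∂μ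
      ≤ ∫⁻ t in Ioi (0 : ℝ), (∫⁻ ω, Z ω ∂μ) * (μ {ω | t < W ω}
          + (Iio K).indicator (fun _ => ENNReal.ofReal (phiCoef X μ n)) t) := by
        refine lintegral_mono fun t => ?_
        by_cases ht : t < K
        · rw [indicator_of_mem (show t ∈ Iio K from ht), mul_comm]
          exact setLIntegral_le_of_mixing hX hk hZ (hset t)
        · have : {ω | t < W ω} = ∅ := by
            exact eq_empty_of_forall_notMem fun ω (h : t < W ω) => ht (h.trans_le (hWK ω))
          simp [this]
    _ = _ := by
        have hmeas : Measurable fun t : ℝ => μ {ω | t < W ω}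
            + (Iio K).indicator (fun _ => ENNReal.ofReal (phiCoef X μ n)) t :=
          hanti.measurable.add (measurable_const.indicator measurableSet_Iio)
        rw [lintegral_const_mul _ hmeas, lintegral_add_left hanti.measurable, lintegral_indicator measurableSet_Iio,
          setLIntegral_const, Measure.restrict_apply measurableSet_Iio, Iio_inter_Ioi,
          Real.volume_Ioo, sub_zero, mul_comm (ENNReal.ofReal K)]

theorem integral_mul_le_of_mixing (hX : ∀ i, Measurable (X i)) {k n : ℕ} (hk : 1 ≤ k)
    {Z W : Ω → ℝ} (hZ : Measurable[sigmaGen X {i | 1 ≤ i ∧ i ≤ k}] Z)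
    (hW : Measurable[sigmaGen X {i | k + n ≤ i}] W) {L K : ℝ} (hZ0 : ∀ ω, 0 ≤ Z ω)
    (hZL : ∀ ω, Z ω ≤ L) (hW0 : ∀ ω, 0 ≤ W ω) (hWK : ∀ ω, W ω ≤ K) :
    ∫ ω, Z ω * W ω ∂μ ≤ (∫ ω, Z ω ∂μ) * (∫ ω, W ω ∂μ + K * phiCoef X μ n) := by
  have hZm : Measurable Z := hZ.mono (sigmaGen_le hX _) le_rfl
  have hWm : Measurable W := hW.mono (sigmaGen_le hX _) le_rfl
  have hZi : Integrable Z μ := .of_bound hZm.aestronglyMeasurable L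
    (ae_of_all _ fun ω => by rw [Real.norm_of_nonneg (hZ0 ω)]; exact hZL ω)
  have hWi : Integrable W μ := .of_bound hWm.aestronglyMeasurable K
    (ae_of_all _ fun ω => by rw [Real.norm_of_nonneg (hW0 ω)]; exact hWK ω)
  have hZWi : Integrable (fun ω => Z ω * W ω) μ :=
    hWi.bdd_mul hZm.aestronglyMeasurable
      (ae_of_all _ fun ω => by rw [Real.norm_of_nonneg (hZ0 ω)]; exact hZL ω)
  have hK : 0 ≤ K := by
    obtain ⟨ω⟩ : Nonempty Ω := nonempty_of_isProbabilityMeasure μ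
    exact (hW0 ω).trans (hWK ω)
  have h := lintegral_mul_le_of_mixing (μ := μ) hX hk hZ.ennreal_ofReal hW hW0 hWK
  simp only [← ENNReal.ofReal_mul (hZ0 _)] at h
  rw [← ofReal_integral_eq_lintegral_ofReal hZi (ae_of_all _ hZ0),
    ← ofReal_integral_eq_lintegral_ofReal hWi (ae_of_all _ hW0),
    ← ofReal_integral_eq_lintegral_ofReal hZWi
      (ae_of_all _ fun ω => mul_nonneg (hZ0 ω) (hW0 ω)),
    ← ENNReal.ofReal_mul hK,
    ← ENNReal.ofReal_add (integral_nonneg hW0) (mul_nonneg hK (phiCoef_nonneg n)),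
    ← ENNReal.ofReal_mul (integral_nonneg hZ0)] at h
  exact (ENNReal.ofReal_le_ofReal_iff (mul_nonneg (integral_nonneg hZ0)
    (add_nonneg (integral_nonneg hW0) (mul_nonneg hK (phiCoef_nonneg n))))).1 h

theorem integrable_exp_mul_sum_centeredInd (hX : ∀ i, Measurable (X i)) (hB : MeasurableSet B)
    (hq0 : 0 ≤ q) (hq1 : q ≤ 1) (I : Finset ℕ) (t : ℝ) :
    Integrable (fun ω => Real.exp (t * ∑ i ∈ I, centeredInd X B q i ω)) μ := by
  have hm : Measurable fun ω => ∑ i ∈ I, centeredInd X B q i ω :=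
    (measurable_sum_centeredInd (S := univ) (fun _ _ => mem_univ _) hB).mono
      (sigmaGen_le hX _) le_rfl
  refine .of_bound (Real.measurable_exp.comp (hm.const_mul t)).aestronglyMeasurable (Real.exp (|t| * I.card)) (ae_of_all _ fun ω => ?_)
  rw [Real.norm_of_nonneg (Real.exp_nonneg _)]
  exact exp_mul_sum_centeredInd_le hq0 hq1 I t ω

theorem integrable_centeredInd (hX : ∀ i, Measurable (X i)) (hB : MeasurableSet B) (i : ℕ) :
    Integrable (centeredInd X B q i) μ :=
  ((integrable_const (1 : ℝ)).indicator (hX i hB)).sub (integrable_const q)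

theorem integral_centeredInd (hX : ∀ i, Measurable (X i)) (hB : MeasurableSet B)
    (hq : ∀ i, 1 ≤ i → μ.real (X i ⁻¹' B) = q) {i : ℕ} (hi : 1 ≤ i) :
    ∫ ω, centeredInd X B q i ω ∂μ = 0 := by
  unfold centeredInd
  rw [integral_sub ((integrable_const (1 : ℝ)).indicator (hX i hB)) (integrable_const q),
    integral_indicator_const _ (hX i hB), hq i hi]
  simp

theorem integral_centeredInd_mul_le (hX : ∀ i, Measurable (X i)) (hB : MeasurableSet B)
    (hq : ∀ i, 1 ≤ i → μ.real (X i ⁻¹' B) = q) {i j : ℕ} (hi : 1 ≤ i) (hij : i ≤ j) :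
    ∫ ω, centeredInd X B q i ω * centeredInd X B q j ω ∂μ ≤ phiCoef X μ (j - i) * q := by
  have hmi := hX i hB
  have hmj := hX j hB
  have h1 : Integrable ((X i ⁻¹' B ∩ X j ⁻¹' B).indicator fun _ => (1 : ℝ)) μ :=
    (integrable_const (1 : ℝ)).indicator (hmi.inter hmj)
  have h2 : Integrable (fun ω => q * centeredInd X B q j ω) μ :=
    (integrable_centeredInd hX hB j).const_mul q
  have h3 : Integrable ((X i ⁻¹' B).indicator fun _ => q) μ :=
    (integrable_const q).indicator hmi
  have heq : ∀ ω, centeredInd X B q i ω * centeredInd X B q j ω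
      = (X i ⁻¹' B ∩ X j ⁻¹' B).indicator (fun _ => (1 : ℝ)) ω
        - (X i ⁻¹' B).indicator (fun _ => q) ω - q * centeredInd X B q j ω := by
    intro ω
    unfold centeredInd
    by_cases hωi : ω ∈ X i ⁻¹' B <;> by_cases hωj : ω ∈ X j ⁻¹' B <;>
      simp [indicator, hωi, hωj] <;> ring
  simp only [heq]
  have h4 : Integrable (fun ω => (X i ⁻¹' B ∩ X j ⁻¹' B).indicator (fun _ => (1 : ℝ)) ω
      - (X i ⁻¹' B).indicator (fun _ => q) ω) μ := h1.sub h3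
  rw [integral_sub h4 h2, integral_sub h1 h3, integral_const_mul,
    integral_centeredInd hX hB hq (hi.trans hij), integral_indicator_const _ (hmi.inter hmj),
    integral_indicator_const _ hmi, hq i hi]
  have h := (abs_le.1 (abs_measureReal_inter_sub_le (μ := μ) (X := X) (n := j - i) hi
    (measurable_sigmaGen (S := {l | 1 ≤ l ∧ l ≤ i}) (i := i) ⟨hi, le_rfl⟩ hB)
    (measurable_sigmaGen (S := {l | i + (j - i) ≤ l}) (i := j)
      (show i + (j - i) ≤ j by omega) hB))).2
  rw [hq i hi, hq j (hi.trans hij)] at h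
  simpa using h

theorem integral_sq_sum_centeredInd_le (hX : ∀ i, Measurable (X i)) (hB : MeasurableSet B)
    (hq : ∀ i, 1 ≤ i → μ.real (X i ⁻¹' B) = q) (hφ : Summable (phiCoef X μ)) {I : Finset ℕ}
    (hI : ∀ i ∈ I, 1 ≤ i) :
    ∫ ω, (∑ i ∈ I, centeredInd X B q i ω) ^ 2 ∂μ
      ≤ 2 * I.card * (∑' k, phiCoef X μ k) * q := by
  have hq0 : 0 ≤ q := by rw [← hq 1 le_rfl]; exact measureReal_nonneg
  have hq1 : q ≤ 1 := by rw [← hq 1 le_rfl]; exact measureReal_le_one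
  have hint : ∀ i j, Integrable (fun ω => centeredInd X B q i ω * centeredInd X B q j ω) μ :=
    fun i j => (integrable_centeredInd hX hB j).bdd_mul
      (integrable_centeredInd hX hB i).aestronglyMeasurable
      (ae_of_all _ fun ω => abs_centeredInd_le hq0 hq1 i ω)
  simp only [sq, Finset.sum_mul_sum]
  rw [integral_finsetSum _ fun i _ => integrable_finsetSum _ fun j _ => hint i j]
  simp only [integral_finsetSum _ fun j _ => hint _ j]
  have hcov : ∀ i ∈ I, ∀ j ∈ I, ∫ ω, centeredInd X B q i ω * centeredInd X B q j ω ∂μ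
      ≤ ((if i ≤ j then phiCoef X μ (j - i) else 0)
        + (if j ≤ i then phiCoef X μ (i - j) else 0)) * q := by
    intro i hi j hj
    rcases le_total i j with h | h
    · refine (integral_centeredInd_mul_le hX hB hq (hI i hi) h).trans ?_
      rw [if_pos h]
      refine mul_le_mul_of_nonneg_right (le_add_of_nonneg_right ?_) hq0
      split_ifs
      exacts [phiCoef_nonneg _, le_rfl]
    · simp only [mul_comm (centeredInd X B q i _)]
      refine (integral_centeredInd_mul_le hX hB hq (hI j hj) h).trans ?_
      rw [if_pos h]
      refine mul_le_mul_of_nonneg_right (le_add_of_nonneg_left ?_) hq0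
      split_ifs
      exacts [phiCoef_nonneg _, le_rfl]
  have hright : ∀ i, ∑ j ∈ I, (if i ≤ j then phiCoef X μ (j - i) else 0) ≤ ∑' k, phiCoef X μ k := by
    intro i
    rw [← Finset.sum_filter, ← Finset.sum_image (f := phiCoef X μ) (g := fun j => j - i)]
    · exact hφ.sum_le_tsum _ fun _ _ => phiCoef_nonneg _
    · intro a ha b hb hab
      simp only [Finset.coe_filter, mem_ofPred_eq] at ha hb hab
      omega
  have hleft : ∀ i, ∑ j ∈ I, (if j ≤ i then phiCoef X μ (i - j) else 0) ≤ ∑' k, phiCoef X μ k := by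
    intro i
    rw [← Finset.sum_filter, ← Finset.sum_image (f := phiCoef X μ) (g := fun j => i - j)]
    · exact hφ.sum_le_tsum _ fun _ _ => phiCoef_nonneg _
    · intro a ha b hb hab
      simp only [Finset.coe_filter, mem_ofPred_eq] at ha hb hab
      omega
  calc _ ≤ ∑ i ∈ I, ∑ j ∈ I, ((if i ≤ j then phiCoef X μ (j - i) else 0)
        + (if j ≤ i then phiCoef X μ (i - j) else 0)) * q :=
        Finset.sum_le_sum fun i hi => Finset.sum_le_sum fun j hj => hcov i hi j hj
    _ ≤ ∑ i ∈ I, 2 * (∑' k, phiCoef X μ k) * q := by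
        refine Finset.sum_le_sum fun i _ => ?_
        rw [← Finset.sum_mul, Finset.sum_add_distrib]
        exact mul_le_mul_of_nonneg_right (by linarith [hright i, hleft i]) hq0
    _ = _ := by
        rw [Finset.sum_const, nsmul_eq_mul]
        ring

theorem integral_exp_block_le (hX : ∀ i, Measurable (X i)) (hB : MeasurableSet B)
    (hq : ∀ i, 1 ≤ i → μ.real (X i ⁻¹' B) = q) (hφ : Summable (phiCoef X μ)) {I : Finset ℕ}
    (hI : ∀ i ∈ I, 1 ≤ i) {m : ℕ} (hIm : I.card ≤ m) {t : ℝ} (ht : |t| * m ≤ 1) :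
    ∫ ω, Real.exp (t * ∑ i ∈ I, centeredInd X B q i ω) ∂μ
      ≤ 1 + 2 * t ^ 2 * m * (∑' k, phiCoef X μ k) * q := by
  have hq0 : 0 ≤ q := by rw [← hq 1 le_rfl]; exact measureReal_nonneg
  have hq1 : q ≤ 1 := by rw [← hq 1 le_rfl]; exact measureReal_le_one
  have hsum : Integrable (fun ω => ∑ i ∈ I, centeredInd X B q i ω) μ :=
    integrable_finsetSum _ fun i _ => integrable_centeredInd hX hB i
  have hsq : Integrable (fun ω => (∑ i ∈ I, centeredInd X B q i ω) ^ 2) μ := by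
    simp only [sq]
    exact hsum.bdd_mul hsum.aestronglyMeasurable
      (ae_of_all _ fun ω => abs_sum_centeredInd_le hq0 hq1 I ω)
  have hpt : ∀ ω, Real.exp (t * ∑ i ∈ I, centeredInd X B q i ω)
      ≤ 1 + t * (∑ i ∈ I, centeredInd X B q i ω)
        + t ^ 2 * (∑ i ∈ I, centeredInd X B q i ω) ^ 2 := by
    intro ω
    have h1 : |t * ∑ i ∈ I, centeredInd X B q i ω| ≤ 1 := by
      rw [abs_mul]
      refine (mul_le_mul_of_nonneg_left ?_ (abs_nonneg t)).trans ht
      exact (abs_sum_centeredInd_le hq0 hq1 I ω).trans (by exact_mod_cast hIm)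
    have h2 := (abs_le.1 (Real.abs_exp_sub_one_sub_id_le h1)).2
    rw [mul_pow] at h2
    linarith
  have hlin : Integrable (fun ω => 1 + t * ∑ i ∈ I, centeredInd X B q i ω) μ :=
    (integrable_const 1).add (hsum.const_mul t)
  have hmono := integral_mono (integrable_exp_mul_sum_centeredInd (μ := μ) hX hB hq0 hq1 I t)
    (hlin.add (hsq.const_mul (t ^ 2))) hpt
  have hval : ∫ ω, (1 + t * (∑ i ∈ I, centeredInd X B q i ω)
        + t ^ 2 * (∑ i ∈ I, centeredInd X B q i ω) ^ 2) ∂μ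
      = 1 + t ^ 2 * ∫ ω, (∑ i ∈ I, centeredInd X B q i ω) ^ 2 ∂μ := by
    rw [integral_add hlin (hsq.const_mul _), integral_add (integrable_const 1) (hsum.const_mul t),
      integral_const_mul, integral_const_mul,
      integral_finsetSum _ fun i _ => integrable_centeredInd hX hB i,
      Finset.sum_eq_zero fun i hi => integral_centeredInd hX hB hq (hI i hi)]
    simp
  have hvar := integral_sq_sum_centeredInd_le hX hB hq hφ hI
  have hW : 0 ≤ ∑' k, phiCoef X μ k := tsum_nonneg fun _ => phiCoef_nonneg _
  calc _ ≤ 1 + t ^ 2 * ∫ ω, (∑ i ∈ I, centeredInd X B q i ω) ^ 2 ∂μ := hmono.trans_eq hval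
    _ ≤ 1 + t ^ 2 * (2 * m * (∑' k, phiCoef X μ k) * q) := by
        gcongr
        refine hvar.trans ?_
        gcongr
    _ = _ := by ring

theorem integral_exp_union_le (hX : ∀ i, Measurable (X i)) (hB : MeasurableSet B)
    (hq0 : 0 ≤ q) (hq1 : q ≤ 1) {P Q : Finset ℕ} (hP : ∀ i ∈ P, 1 ≤ i) {m : ℕ}
    (hPQ : ∀ i ∈ P, ∀ j ∈ Q, i + m ≤ j) (hQ : Q.card ≤ m) {t : ℝ} (ht : |t| * m ≤ 1) :
    ∫ ω, Real.exp (t * (∑ i ∈ P, centeredInd X B q i ω + ∑ i ∈ Q, centeredInd X B q i ω)) ∂μ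
      ≤ (∫ ω, Real.exp (t * ∑ i ∈ P, centeredInd X B q i ω) ∂μ)
        * (∫ ω, Real.exp (t * ∑ i ∈ Q, centeredInd X B q i ω) ∂μ + 3 * phiCoef X μ m) := by
  have hφ0 : 0 ≤ phiCoef X μ m := phiCoef_nonneg m
  rcases P.eq_empty_or_nonempty with rfl | hne
  · simpa using hφ0
  simp only [mul_add t, Real.exp_add]
  refine integral_mul_le_of_mixing (μ := μ) hX (k := P.max' hne) (hP _ (P.max'_mem hne))
    (L := Real.exp (|t| * P.card)) ?_ ?_ (fun _ => Real.exp_nonneg _)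
    (exp_mul_sum_centeredInd_le hq0 hq1 P t) (fun _ => Real.exp_nonneg _) fun ω => ?_
  · exact Real.measurable_exp.comp ((measurable_sum_centeredInd
      (S := {i | 1 ≤ i ∧ i ≤ P.max' hne}) (fun i hi => ⟨hP i hi, P.le_max' i hi⟩) hB).const_mul t)
  · exact Real.measurable_exp.comp ((measurable_sum_centeredInd
      (S := {i | P.max' hne + m ≤ i}) (fun j hj => hPQ _ (P.max'_mem hne) j hj) hB).const_mul t)
  · refine (exp_mul_sum_centeredInd_le hq0 hq1 Q t ω).trans ?_
    refine (Real.exp_le_exp.2 ?_).trans Real.exp_one_lt_three.le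
    refine (mul_le_mul_of_nonneg_left ?_ (abs_nonneg t)).trans ht
    exact_mod_cast hQ

theorem integral_exp_blocks_le (hX : ∀ i, Measurable (X i)) (hB : MeasurableSet B)
    (hq : ∀ i, 1 ≤ i → μ.real (X i ⁻¹' B) = q) (hφ : Summable (phiCoef X μ)) {I : Finset ℕ}
    (hI : ∀ i ∈ I, 1 ≤ i) {m : ℕ} {g : ℕ → ℕ}
    (hg : ∀ i ∈ I, ∀ j ∈ I, g i < g j → i + m ≤ j)
    (hgm : ∀ b, (I.filter (g · = b)).card ≤ m) {t : ℝ} (ht : |t| * m ≤ 1) (k : ℕ) :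
    ∫ ω, Real.exp (t * ∑ i ∈ I.filter (g · < k), centeredInd X B q i ω) ∂μ
      ≤ Real.exp (k * (2 * t ^ 2 * m * (∑' k, phiCoef X μ k) * q + 3 * phiCoef X μ m)) := by
  have hq0 : 0 ≤ q := by rw [← hq 1 le_rfl]; exact measureReal_nonneg
  have hq1 : q ≤ 1 := by rw [← hq 1 le_rfl]; exact measureReal_le_one
  induction k with
  | zero => simp
  | succ k ih =>
    have hsplit : I.filter (g · < k + 1) = I.filter (g · < k) ∪ I.filter (g · = k) := by
      rw [← Finset.filter_or]
      exact Finset.filter_congr fun i _ => by omega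
    have hdisj : Disjoint (I.filter (g · < k)) (I.filter (g · = k)) :=
      Finset.disjoint_filter.2 fun i _ h h' => by omega
    simp only [hsplit, Finset.sum_union hdisj]
    refine (integral_exp_union_le hX hB hq0 hq1
      (fun i hi => hI i (Finset.mem_filter.1 hi).1) (fun i hi j hj => ?_) (hgm k) ht).trans ?_
    · rw [Finset.mem_filter] at hi hj
      exact hg i hi.1 j hj.1 (by omega)
    · have hblock := integral_exp_block_le hX hB hq hφ
        (fun i hi => hI i (Finset.mem_filter.1 hi).1) (hgm k) ht
      rw [Nat.cast_succ, add_mul, one_mul, Real.exp_add]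
      refine mul_le_mul ih ?_ ?_ (Real.exp_nonneg _)
      · refine le_trans ?_ (Real.add_one_le_exp _)
        linarith
      · exact add_nonneg (integral_nonneg fun _ => Real.exp_nonneg _)
          (mul_nonneg (by norm_num) (phiCoef_nonneg m))

theorem measureReal_half_sum_ge_le (hX : ∀ i, Measurable (X i)) (hB : MeasurableSet B)
    (hq : ∀ i, 1 ≤ i → μ.real (X i ⁻¹' B) = q) (hφ : Summable (phiCoef X μ)) {m : ℕ}
    (hm : 1 ≤ m) (n c : ℕ) {t : ℝ} (ht0 : 0 ≤ t) (ht : t * m ≤ 1) {σ : ℝ} (hσ : |σ| = 1)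
    (ε : ℝ) :
    μ.real {ω | ε ≤ σ * ∑ i ∈ (Finset.Icc 1 n).filter (fun i => i / m % 2 = c),
        centeredInd X B q i ω}
      ≤ Real.exp (-t * ε + (n / (2 * m) + 1 : ℕ)
        * (2 * t ^ 2 * m * (∑' k, phiCoef X μ k) * q + 3 * phiCoef X μ m)) := by
  have hq0 : 0 ≤ q := by rw [← hq 1 le_rfl]; exact measureReal_nonneg
  have hq1 : q ≤ 1 := by rw [← hq 1 le_rfl]; exact measureReal_le_one
  set I := (Finset.Icc 1 n).filter (fun i => i / m % 2 = c) with hIdef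
  have hmem : ∀ i ∈ I, 1 ≤ i ∧ i ≤ n ∧ i / m % 2 = c := by
    intro i hi
    rw [hIdef, Finset.mem_filter, Finset.mem_Icc] at hi
    exact ⟨hi.1.1, hi.1.2, hi.2⟩
  have hg : ∀ i ∈ I, ∀ j ∈ I, i / m / 2 < j / m / 2 → i + m ≤ j := by
    intro i hi j hj hij
    have h1 : i / m + 2 ≤ j / m := by have := hmem i hi; have := hmem j hj; omega
    have h2 : i < m * (i / m + 1) := by
      have h3 := Nat.lt_mul_div_succ i hm
      exact h3
    have h4 : m * (j / m) ≤ j := Nat.mul_div_le j m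
    have h5 : m * (i / m + 2) ≤ m * (j / m) := Nat.mul_le_mul_left m h1
    nlinarith
  have hgm : ∀ b, (I.filter (fun i => i / m / 2 = b)).card ≤ m := by
    intro b
    have hsub : I.filter (fun i => i / m / 2 = b)
        ⊆ Finset.Ico (m * (2 * b + c)) (m * (2 * b + c) + m) := by
      intro i hi
      rw [Finset.mem_filter] at hi
      have h1 : i / m = 2 * b + c := by have := hmem i hi.1; omega
      have h3 := Nat.lt_mul_div_succ i hm
      have h4 : m * (i / m) ≤ i := Nat.mul_div_le i m
      rw [h1] at h3 h4
      rw [Finset.mem_Ico]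
      exact ⟨h4, by linarith [mul_add m (2 * b + c) 1]⟩
    simpa using Finset.card_le_card hsub
  have hall : I.filter (fun i => i / m / 2 < n / (2 * m) + 1) = I := by
    refine Finset.filter_true_of_mem fun i hi => ?_
    rw [Nat.div_div_eq_div_mul, mul_comm m 2, Nat.lt_succ_iff]
    exact Nat.div_le_div_right (hmem i hi).2.1
  have habs : |t * σ| * m ≤ 1 := by rwa [abs_mul, hσ, mul_one, abs_of_nonneg ht0]
  have hσ2 : σ ^ 2 = 1 := by rw [← sq_abs, hσ, one_pow]
  have hexp := integral_exp_blocks_le hX hB hq hφ (fun i hi => (hmem i hi).1) hg hgm habs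
    (n / (2 * m) + 1)
  rw [hall, mul_pow, hσ2, mul_one] at hexp
  simp only [mul_assoc t σ] at hexp
  have hint := integrable_exp_mul_sum_centeredInd (μ := μ) hX hB hq0 hq1 I (t * σ)
  simp only [mul_assoc t σ] at hint
  refine (ProbabilityTheory.measure_ge_le_exp_mul_mgf ε ht0 hint).trans ?_
  rw [Real.exp_add]
  exact mul_le_mul_of_nonneg_left hexp (Real.exp_nonneg _)

theorem measureReal_abs_sum_ge_le (hX : ∀ i, Measurable (X i)) (hB : MeasurableSet B)
    (hq : ∀ i, 1 ≤ i → μ.real (X i ⁻¹' B) = q) (hφ : Summable (phiCoef X μ)) {m : ℕ}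
    (hm : 1 ≤ m) (n : ℕ) {t : ℝ} (ht0 : 0 ≤ t) (ht : t * m ≤ 1) (ε : ℝ) :
    μ.real {ω | 2 * ε ≤ |∑ i ∈ Finset.Icc 1 n, centeredInd X B q i ω|}
      ≤ 4 * Real.exp (-t * ε + (n / (2 * m) + 1 : ℕ)
        * (2 * t ^ 2 * m * (∑' k, phiCoef X μ k) * q + 3 * phiCoef X μ m)) := by
  set H : ℕ → ℝ → Set Ω := fun c σ => {ω | ε ≤ σ *
    ∑ i ∈ (Finset.Icc 1 n).filter (fun i => i / m % 2 = c), centeredInd X B q i ω} with hH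
  have hbound : ∀ c σ, |σ| = 1 → μ.real (H c σ) ≤ Real.exp (-t * ε + (n / (2 * m) + 1 : ℕ)
        * (2 * t ^ 2 * m * (∑' k, phiCoef X μ k) * q + 3 * phiCoef X μ m)) := fun c σ hσ =>
    measureReal_half_sum_ge_le hX hB hq hφ hm n c ht0 ht hσ ε
  have hsub : {ω | 2 * ε ≤ |∑ i ∈ Finset.Icc 1 n, centeredInd X B q i ω|}
      ⊆ (H 0 1 ∪ H 1 1) ∪ (H 0 (-1) ∪ H 1 (-1)) := by
    intro ω (hω : 2 * ε ≤ |∑ i ∈ Finset.Icc 1 n, centeredInd X B q i ω|)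
    have hcongr : (Finset.Icc 1 n).filter (fun i => ¬ i / m % 2 = 0)
        = (Finset.Icc 1 n).filter (fun i => i / m % 2 = 1) :=
      Finset.filter_congr fun i _ => by omega
    rw [← Finset.sum_filter_add_sum_filter_not (Finset.Icc 1 n) (fun i => i / m % 2 = 0),
      hcongr] at hω
    simp only [hH, mem_union, mem_ofPred_eq]
    by_contra! hcon
    obtain ⟨⟨h1, h2⟩, h3, h4⟩ := hcon
    rcases le_abs'.1 hω with h | h <;> linarith
  have h1 := hbound 0 1 (by simp)
  have h2 := hbound 1 1 (by simp)
  have h3 := hbound 0 (-1) (by simp)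
  have h4 := hbound 1 (-1) (by simp)
  have h5 := measureReal_mono (μ := μ) hsub
  have h6 := measureReal_union_le (μ := μ) (H 0 1 ∪ H 1 1) (H 0 (-1) ∪ H 1 (-1))
  have h7 := measureReal_union_le (μ := μ) (H 0 1) (H 1 1)
  have h8 := measureReal_union_le (μ := μ) (H 0 (-1)) (H 1 (-1))
  linarith

theorem exists_bernstein_bound (hX : ∀ i, Measurable (X i))
    (hphi : (fun n : ℕ => phiCoef X μ n) =O[atTop] fun n : ℕ => ((n : ℝ) ^ 3)⁻¹) :
    ∃ C : ℝ, 0 ≤ C ∧ ∀ n : ℕ, 1 ≤ n → ∀ (B : Set ℝ) (q : ℝ), MeasurableSet B →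
      (∀ i, 1 ≤ i → μ.real (X i ⁻¹' B) = q) → ∀ t : ℝ, 0 ≤ t →
      t * (2 * (n : ℝ) ^ (1 / 4 : ℝ)) ≤ 1 → ∀ ε : ℝ,
      μ.real {ω | 2 * ε ≤ |∑ i ∈ Finset.Icc 1 n, centeredInd X B q i ω|}
        ≤ 4 * Real.exp (-t * ε + C * (t ^ 2 * n * q + 1)) := by
  have hφ : Summable (phiCoef X μ) :=
    summable_of_isBigO_nat (Real.summable_nat_pow_inv.2 (by norm_num)) hphi
  obtain ⟨C₀, hC₀, hbound⟩ := Asymptotics.bound_of_isBigO_nat_atTop hphi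
  set W := ∑' k, phiCoef X μ k with hWdef
  have hW : 0 ≤ W := tsum_nonneg fun _ => phiCoef_nonneg _
  refine ⟨4 * W + 6 * C₀, by positivity, fun n hn B q hB hq t ht0 ht ε => ?_⟩
  have hq0 : 0 ≤ q := by rw [← hq 1 le_rfl]; exact measureReal_nonneg
  have hn' : (1 : ℝ) ≤ n := by exact_mod_cast hn
  set u := (n : ℝ) ^ (1 / 4 : ℝ) with hu
  have hu1 : 1 ≤ u := Real.one_le_rpow hn' (by norm_num)
  have hu4 : u ^ 4 = n := by
    rw [hu, ← Real.rpow_natCast, ← Real.rpow_mul (by positivity)]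
    norm_num
  set m := ⌈u⌉₊ with hmdef
  have hum : u ≤ m := Nat.le_ceil u
  have hmu : (m : ℝ) ≤ 2 * u := by linarith [(Nat.ceil_lt_add_one (by linarith : 0 ≤ u)).le]
  have hm1 : (1 : ℝ) ≤ m := hu1.trans hum
  have hm : 1 ≤ m := by exact_mod_cast hm1
  have hmn : m ≤ n := by
    refine Nat.ceil_le.2 ?_
    rw [← hu4]
    exact le_self_pow₀ hu1 (by norm_num)
  have hnm : (n : ℝ) ≤ m ^ 4 := by
    rw [← hu4]
    gcongr
  have hφm : phiCoef X μ m ≤ C₀ * ((m : ℝ) ^ 3)⁻¹ := by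
    have h := hbound (x := m) (by positivity)
    rw [Real.norm_of_nonneg (phiCoef_nonneg m), Real.norm_of_nonneg (by positivity)] at h
    exact h
  set k := n / (2 * m) + 1 with hkdef
  have hkm : (k : ℝ) * m ≤ 2 * n := by
    have h1 : 2 * m * (n / (2 * m)) ≤ n := Nat.mul_div_le n (2 * m)
    have h2 : k * m ≤ 2 * n := by
      rw [hkdef]
      nlinarith
    exact_mod_cast h2
  have hkφ : k * phiCoef X μ m ≤ 2 * C₀ := by
    calc k * phiCoef X μ m ≤ k * (C₀ * ((m : ℝ) ^ 3)⁻¹) := by gcongr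
      _ = C₀ * (k * m / m ^ 4) := by field_simp
      _ ≤ C₀ * 2 := by
          gcongr
          rw [div_le_iff₀ (by positivity)]
          linarith
      _ = 2 * C₀ := mul_comm _ _
  have htm : t * m ≤ 1 := (mul_le_mul_of_nonneg_left hmu ht0).trans ht
  refine (measureReal_abs_sum_ge_le hX hB hq hφ hm n ht0 htm ε).trans ?_
  have hfinal : (k : ℝ) * (2 * t ^ 2 * m * W * q + 3 * phiCoef X μ m)
      ≤ (4 * W + 6 * C₀) * (t ^ 2 * n * q + 1) := by
    have h1 : 2 * t ^ 2 * W * q * (k * m) ≤ 2 * t ^ 2 * W * q * (2 * n) := by gcongr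
    have h2 : 0 ≤ C₀ * (t ^ 2 * n * q) := by positivity
    nlinarith
  gcongr

end Mixing

section EmpiricalDistribution

variable {Ω : Type*} {X : ℕ → Ω → ℝ}

theorem sum_centeredInd_Iic {n : ℕ} (hn : 1 ≤ n) (ω : Ω) (x q : ℝ) :
    ∑ i ∈ Finset.Icc 1 n, centeredInd X (Iic x) q i ω = n * (empDF X n ω x - q) := by
  have hn' : (n : ℝ) ≠ 0 := by positivity
  have h : ∀ i, centeredInd X (Iic x) q i ω = (if X i ω ≤ x then (1 : ℝ) else 0) - q := by
    intro i
    simp [centeredInd, indicator]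
  simp only [h, Finset.sum_sub_distrib, empDF, Finset.sum_const, Nat.card_Icc, nsmul_eq_mul,
    add_tsub_cancel_right]
  field_simp

theorem sum_centeredInd_Ioc {n : ℕ} (hn : 1 ≤ n) (ω : Ω) {x y : ℝ} (hxy : x ≤ y) (a b : ℝ) :
    ∑ i ∈ Finset.Icc 1 n, centeredInd X (Ioc x y) (b - a) i ω
      = n * (empDF X n ω y - empDF X n ω x - (b - a)) := by
  have h : ∀ i, centeredInd X (Ioc x y) (b - a) i ω
      = centeredInd X (Iic y) b i ω - centeredInd X (Iic x) a i ω := by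
    intro i
    unfold centeredInd
    by_cases h1 : X i ω ≤ x
    · simp [indicator, h1, h1.trans hxy, not_lt.2 h1]
    · by_cases h2 : X i ω ≤ y
      · simp [indicator, h1, h2, not_le.1 h1]
        ring
      · simp [indicator, h1, h2]
        ring
  simp only [h, Finset.sum_sub_distrib, sum_centeredInd_Iic hn]
  ring

theorem monotone_empDF (n : ℕ) (ω : Ω) : Monotone (empDF X n ω) := by
  intro x y hxy
  refine mul_le_mul_of_nonneg_left (Finset.sum_le_sum fun i _ => ?_) (by positivity)
  split_ifs with h1 h2
  exacts [le_rfl, absurd (h1.trans hxy) h2, zero_le_one, le_rfl]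

theorem lt_of_lt_sInf_superlevel {G : ℝ → ℝ} {p y x₀ : ℝ} (hG : Monotone G) (h₀ : G x₀ < p)
    (hy : y < sInf {x | p ≤ G x}) : G y < p :=
  not_le.1 fun h : p ≤ G y => notMem_of_lt_csInf (s := {x | p ≤ G x}) hy ⟨x₀, fun _ hx =>
    le_of_not_gt fun hlt => (h₀.trans_le hx).not_ge (hG hlt.le)⟩ h

theorem le_of_sInf_superlevel_lt {G : ℝ → ℝ} {p y x₁ : ℝ} (hG : Monotone G) (h₁ : p ≤ G x₁)
    (hy : sInf {x | p ≤ G x} < y) : p ≤ G y := by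
  obtain ⟨z, hz, hzy⟩ := exists_lt_of_csInf_lt ⟨x₁, h₁⟩ hy
  exact le_trans hz (hG hzy.le)

theorem exists_empDF_eq_zero (n : ℕ) (ω : Ω) : ∃ x, empDF X n ω x = 0 := by
  obtain ⟨c, hc⟩ := ((Finset.Icc 1 n).image fun i => X i ω).bddBelow
  refine ⟨c - 1, ?_⟩
  rw [empDF, Finset.sum_eq_zero, mul_zero]
  intro i hi
  have := hc (Finset.mem_image_of_mem (fun i => X i ω) hi)
  exact if_neg (by linarith)

theorem exists_empDF_eq_one {n : ℕ} (hn : 1 ≤ n) (ω : Ω) : ∃ x, empDF X n ω x = 1 := by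
  obtain ⟨c, hc⟩ := ((Finset.Icc 1 n).image fun i => X i ω).bddAbove
  refine ⟨c, ?_⟩
  have h : ∀ i ∈ Finset.Icc 1 n, (if X i ω ≤ c then (1 : ℝ) else 0) = 1 := fun i hi =>
    if_pos (hc (Finset.mem_image_of_mem (fun i => X i ω) hi))
  have hn' : (n : ℝ) ≠ 0 := by positivity
  rw [empDF, Finset.sum_congr rfl h]
  simp [hn']

theorem eq_at_quantile {F : ℝ → ℝ} {p : ℝ} (hF : Monotone F)
    (h₀ : Tendsto F atBot (nhds 0)) (h₁ : Tendsto F atTop (nhds 1)) (hp : 0 < p ∧ p < 1)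
    (hc : ContinuousAt F (quantile F p)) : F (quantile F p) = p := by
  obtain ⟨x₀, hx₀⟩ := (h₀.eventually_lt_const hp.1).exists
  obtain ⟨x₁, hx₁⟩ := (h₁.eventually_const_lt hp.2).exists
  refine le_antisymm ?_ ?_
  · exact le_of_tendsto (hc.mono_left nhdsWithin_le_nhds : Tendsto F (nhdsWithin _ (Iio (quantile F p))) _)
      (eventually_nhdsWithin_of_forall fun y hy => (lt_of_lt_sInf_superlevel hF hx₀ hy).le)
  · exact ge_of_tendsto (hc.mono_left nhdsWithin_le_nhds : Tendsto F (nhdsWithin _ (Ioi (quantile F p))) _)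
      (eventually_nhdsWithin_of_forall fun y hy => le_of_sInf_superlevel_lt hF hx₁.le hy)

end EmpiricalDistribution

theorem abs_sub_linearized_root_le {G : ℝ → ℝ} {p x ξ b e δ : ℝ} {N : ℕ} (hb : 0 < b)
    (hδ : 0 < δ) (he : 0 ≤ e) (hlt : ∀ y < x, G y < p) (hge : ∀ y, x < y → p ≤ G y)
    (hgrid : ∀ r : ℤ, |r| ≤ N → |G (ξ + r * δ) - G ξ - b * (r * δ)| ≤ e)
    (hN : |G ξ - p| / b + e / b + δ ≤ N * δ) :
    |x - (ξ - (G ξ - p) / b)| ≤ e / b + δ := by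
  have hT := le_abs_self (G ξ - p)
  have hT' := neg_abs_le (G ξ - p)
  set s := (G ξ - p) / b with hs
  have hsb : b * s = G ξ - p := by rw [hs]; field_simp
  have hsabs : |s| = |G ξ - p| / b := by rw [hs, abs_div, abs_of_pos hb]
  have hbe : b * (e / b) = e := by field_simp
  have heb : 0 ≤ e / b := by positivity
  rw [← hsabs] at hN
  have hs1 := le_abs_self s
  have hs2 := neg_abs_le s
  have hr : ∀ r : ℤ, |(r : ℝ) * δ| ≤ N * δ → |r| ≤ N := by
    intro r h
    rw [abs_mul, abs_of_pos hδ] at h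
    have := le_of_mul_le_mul_right h hδ
    exact_mod_cast this
  rw [abs_le]
  constructor
  · by_contra! hcon
    set r : ℤ := ⌈(-s - e / b) / δ⌉ - 1 with hrdef
    have h1 : (r : ℝ) * δ < -s - e / b := by
      have := Int.ceil_lt_add_one ((-s - e / b) / δ)
      rw [← lt_div_iff₀ hδ, hrdef]
      push_cast
      linarith
    have h2 : -s - e / b - δ ≤ (r : ℝ) * δ := by
      have := Int.le_ceil ((-s - e / b) / δ)
      rw [div_le_iff₀ hδ] at this
      rw [hrdef]
      push_cast
      linarith
    have h3 := (abs_le.1 (hgrid r (hr r (abs_le.2 ⟨by linarith, by linarith⟩)))).2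
    have h4 := hge (ξ + r * δ) (by linarith)
    have h5 := mul_lt_mul_of_pos_left h1 hb
    linarith
  · by_contra! hcon
    set r : ℤ := ⌊(-s + e / b) / δ⌋ + 1 with hrdef
    have h1 : -s + e / b < (r : ℝ) * δ := by
      have := Int.lt_floor_add_one ((-s + e / b) / δ)
      rw [← div_lt_iff₀ hδ, hrdef]
      push_cast
      linarith
    have h2 : (r : ℝ) * δ ≤ -s + e / b + δ := by
      have := Int.floor_le ((-s + e / b) / δ)
      rw [le_div_iff₀ hδ] at this
      rw [hrdef]
      push_cast
      linarith
    have h3 := (abs_le.1 (hgrid r (hr r (abs_le.2 ⟨by linarith, by linarith⟩)))).1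
    have h4 := hlt (ξ + r * δ) (by linarith)
    have h5 := mul_lt_mul_of_pos_left h1 hb
    linarith

theorem exists_abs_sub_linear_le_sq {F f f' : ℝ → ℝ} {ξ : ℝ} {s : Set ℝ} (hs : s ∈ nhds ξ)
    (hFf : ∀ x ∈ s, HasDerivAt F (f x) x) (hff' : ∀ x ∈ s, HasDerivAt f (f' x) x)
    (hf' : ∃ M : ℝ, ∀ x ∈ s, |f' x| ≤ M) :
    ∃ ρ M : ℝ, 0 < ρ ∧ 0 ≤ M ∧
      ∀ x, |x - ξ| ≤ ρ → |F x - F ξ - f ξ * (x - ξ)| ≤ M * (x - ξ) ^ 2 := by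
  obtain ⟨ρ, hρ, hsub⟩ := Metric.nhds_basis_closedBall.mem_iff.1 hs
  obtain ⟨M, hM⟩ := hf'
  have hM0 : 0 ≤ M := (abs_nonneg _).trans (hM ξ (mem_of_mem_nhds hs))
  refine ⟨ρ, M, hρ, hM0, fun x hx => ?_⟩
  have hball : Metric.closedBall ξ |x - ξ| ⊆ s :=
    (Metric.closedBall_subset_closedBall hx).trans hsub
  have hξ : ξ ∈ Metric.closedBall ξ |x - ξ| := Metric.mem_closedBall_self (abs_nonneg _)
  have hlip : ∀ y ∈ Metric.closedBall ξ |x - ξ|, ‖f y - f ξ‖ ≤ M * |x - ξ| := by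
    intro y hy
    refine ((convex_closedBall ξ |x - ξ|).norm_image_sub_le_of_norm_hasDerivWithin_le
      (fun z hz => (hff' z (hball hz)).hasDerivWithinAt) (fun z hz => hM z (hball hz)) hξ hy).trans ?_
    rw [← dist_eq_norm]
    exact mul_le_mul_of_nonneg_left hy hM0
  have h := (convex_closedBall ξ |x - ξ|).norm_image_sub_le_of_norm_hasDerivWithin_le
    (f := fun y => F y - f ξ * y) (f' := fun y => f y - f ξ)
    (fun z hz => by
      have h := (hFf z (hball hz)).fun_sub ((hasDerivAt_id' z).const_mul (f ξ))
      rw [mul_one] at h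
      exact h.hasDerivWithinAt)
    hlip hξ (show x ∈ Metric.closedBall ξ |x - ξ| from (Real.dist_eq x ξ).le)
  rw [Real.norm_eq_abs, Real.norm_eq_abs, mul_assoc, ← sq, sq_abs] at h
  convert h using 2
  ring

theorem ae_eventually_notMem_of_measureReal_le {Ω : Type*} [MeasurableSpace Ω] {μ : Measure Ω}
    [IsFiniteMeasure μ] {s : ℕ → Set Ω} {K : ℝ}
    (h : ∀ᶠ n : ℕ in atTop, μ.real (s n) ≤ K * ((n : ℝ) ^ 2)⁻¹) :
    ∀ᵐ ω ∂μ, ∀ᶠ n in atTop, ω ∉ s n := by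
  refine ae_eventually_notMem ?_
  have hO : (fun n => μ.real (s n)) =O[atTop] fun n : ℕ => ((n : ℝ) ^ 2)⁻¹ := by
    refine .of_bound K (h.mono fun n hn => ?_)
    rwa [Real.norm_of_nonneg measureReal_nonneg, Real.norm_of_nonneg (by positivity)]
  have hsum := summable_of_isBigO_nat (Real.summable_nat_pow_inv.2 (by norm_num)) hO
  have hμ : ∀ n, ENNReal.ofReal (μ.real (s n)) = μ (s n) := fun n => ofReal_measureReal
  simpa only [hμ] using hsum.tsum_ofReal_ne_top

section Marginal

variable {Ω : Type*} [MeasurableSpace Ω] {μ : Measure Ω} [IsProbabilityMeasure μ]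
  {X : ℕ → Ω → ℝ} {F : ℝ → ℝ}

theorem measureReal_preimage_Ioc (hX : ∀ i, Measurable (X i))
    (hF : ∀ i, 1 ≤ i → ∀ x, F x = μ.real (X i ⁻¹' Iic x)) {i : ℕ} (hi : 1 ≤ i) {x y : ℝ}
    (hxy : x ≤ y) : μ.real (X i ⁻¹' Ioc x y) = F y - F x := by
  have : X i ⁻¹' Ioc x y = X i ⁻¹' Iic y \ X i ⁻¹' Iic x := by
    ext
    simp [and_comm]
  rw [hF i hi y, hF i hi x, this, measureReal_sdiff (preimage_mono (Iic_subset_Iic.2 hxy)) (hX i measurableSet_Iic)]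

theorem cdf_map_eq_of_marginal (hX : ∀ i, Measurable (X i))
    (hF : ∀ i, 1 ≤ i → ∀ x, F x = μ.real (X i ⁻¹' Iic x)) :
    F = ProbabilityTheory.cdf (μ.map (X 1)) := by
  have := Measure.isProbabilityMeasure_map (μ := μ) (hX 1).aemeasurable
  funext x
  rw [ProbabilityTheory.cdf_eq_real, map_measureReal_apply (hX 1) measurableSet_Iic,
    hF 1 le_rfl]

theorem measureReal_empDF_increment_ge_le (hX : ∀ i, Measurable (X i))
    (hF : ∀ i, 1 ≤ i → ∀ x, F x = μ.real (X i ⁻¹' Iic x)) {n : ℕ} (hn : 1 ≤ n) {C t Q ε : ℝ}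
    (hC : 0 ≤ C)
    (hbern : ∀ (B : Set ℝ) (q : ℝ), MeasurableSet B →
      (∀ i, 1 ≤ i → μ.real (X i ⁻¹' B) = q) →
      μ.real {ω | 2 * ε ≤ |∑ i ∈ Finset.Icc 1 n, centeredInd X B q i ω|}
        ≤ 4 * Real.exp (-t * ε + C * (t ^ 2 * n * q + 1)))
    {x y : ℝ} (hQ : |F y - F x| ≤ Q) :
    μ.real {ω | 2 * ε ≤ n * |empDF X n ω y - empDF X n ω x - (F y - F x)|}
      ≤ 4 * Real.exp (-t * ε + C * (t ^ 2 * n * Q + 1)) := by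
  wlog hxy : x ≤ y generalizing x y
  · have h := this (x := y) (y := x) (by rwa [abs_sub_comm]) (le_of_not_ge hxy)
    convert h using 6 with ω
    rw [← abs_neg]
    congr 1
    ring
  have h := hbern (Ioc x y) (F y - F x) measurableSet_Ioc
    fun i hi => measureReal_preimage_Ioc hX hF hi hxy
  simp only [sum_centeredInd_Ioc hn _ hxy, abs_mul, Nat.abs_cast] at h
  refine h.trans ?_
  have := (le_abs_self _).trans hQ
  gcongr

end Marginal

/-- **Theorem 2.2.** For a φ-mixing sequence with `φ(n) = O(n⁻³)`,
`P(X_i = X_j) = 0` for `i ≠ j`, and a marginal distribution function `F` with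
positive continuous density `f` near `ξ_p` (with bounded `f'` there), with probability 1,
`ξ_{p,n} = ξ_p - (F_n(ξ_p) - p) / f(ξ_p) + O(n^{-3/4} log n)` as `n → ∞`. -/
theorem bahadur_thm_2_2 {Ω : Type*} [MeasurableSpace Ω] (μ : Measure Ω)
    [IsProbabilityMeasure μ]
    (X : ℕ → Ω → ℝ) (hX : ∀ i, Measurable (X i))
    (hanti : Antitone (phiCoef X μ))
    (hmix : Tendsto (phiCoef X μ) atTop (nhds 0))
    (hphi : (fun n : ℕ => phiCoef X μ n) =O[atTop] fun n : ℕ => ((n : ℝ) ^ 3)⁻¹)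
    (hdist : ∀ i j, 1 ≤ i → 1 ≤ j → i ≠ j → μ {ω | X i ω = X j ω} = 0)
    (F : ℝ → ℝ) (hF : ∀ i, 1 ≤ i → ∀ x, F x = (μ {ω | X i ω ≤ x}).toReal)
    (p : ℝ) (hp : 0 < p ∧ p < 1)
    (Np : Set ℝ) (hNp : Np ∈ nhds (quantile F p))
    (f : ℝ → ℝ) (hfc : ContinuousOn f Np) (hfpos : ∀ x ∈ Np, 0 < f x)
    (hFf : ∀ x ∈ Np, HasDerivAt F (f x) x)
    (d : ℝ) (hd : IsLUB (f '' Np) d) (hd0 : 0 < d)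
    (f' : ℝ → ℝ) (hff' : ∀ x ∈ Np, HasDerivAt f (f' x) x)
    (hf'bdd : ∃ M : ℝ, ∀ x ∈ Np, |f' x| ≤ M) :
    ∀ᵐ ω ∂μ,
      (fun n : ℕ => sampleQuantile X n ω p -
          (quantile F p - (empDF X n ω (quantile F p) - p) / f (quantile F p)))
        =O[atTop] fun n : ℕ => (n : ℝ) ^ (-(3 : ℝ) / 4) * Real.log n := by
  have hF' : ∀ i, 1 ≤ i → ∀ x, F x = μ.real (X i ⁻¹' Iic x) := hF
  have hcdf := cdf_map_eq_of_marginal hX hF'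
  have hFp : F (quantile F p) = p := by
    refine eq_at_quantile ?_ ?_ ?_ hp (hFf _ (mem_of_mem_nhds hNp)).continuousAt
    · rw [hcdf]; exact ProbabilityTheory.monotone_cdf _
    · rw [hcdf]; exact ProbabilityTheory.tendsto_cdf_atBot _
    · rw [hcdf]; exact ProbabilityTheory.tendsto_cdf_atTop _
  have hb : 0 < f (quantile F p) := hfpos _ (mem_of_mem_nhds hNp)
  obtain ⟨ρ, M, hρ, hM, htaylor⟩ := exists_abs_sub_linear_le_sq hNp hFf hff' hf'bdd
  obtain ⟨C, hC, hbern⟩ := exists_bernstein_bound hX hphi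
  set ξ := quantile F p with hξ
  set b := f ξ with hbdef
  set L := b + M * ρ with hL
  have hL0 : 0 ≤ L := by positivity
  have hlip : ∀ x, |x - ξ| ≤ ρ → |F x - F ξ| ≤ L * |x - ξ| := by
    intro x hx
    have h1 := htaylor x hx
    have h2 : |b * (x - ξ)| = b * |x - ξ| := by rw [abs_mul, abs_of_pos hb]
    have h3 : M * (x - ξ) ^ 2 ≤ M * ρ * |x - ξ| := by
      rw [← sq_abs, sq, ← mul_assoc]
      gcongr
    have h4 := abs_add_le (F x - F ξ - b * (x - ξ)) (b * (x - ξ))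
    rw [sub_add_cancel] at h4
    rw [hL]
    linarith
  set D := 32 / b with hD
  have hD0 : 0 < D := by positivity
  set A := C * L * D / 2 + 8 with hA
  have hA0 : 0 ≤ A := by positivity
  set E := 2 * A + 4 * M * D ^ 2 with hE
  have hE0 : 0 ≤ E := by positivity
  set u : ℕ → ℝ := fun n => (n : ℝ) ^ (1 / 4 : ℝ) with hu
  have hutop : Tendsto u atTop atTop :=
    (tendsto_rpow_atTop (by norm_num)).comp tendsto_natCast_atTop_atTop
  have hu4 : ∀ n, u n ^ 4 = n := fun n => by
    rw [hu, ← Real.rpow_natCast, ← Real.rpow_mul (by positivity)]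
    norm_num
  have hvu : ∀ n : ℕ, Real.log n ≤ 4 * u n := fun n => by
    have := Real.log_le_rpow_div (x := n) (ε := 1 / 4) (by positivity) (by norm_num)
    simp only [hu]
    linarith
  set δ : ℕ → ℝ := fun n => D * Real.log n / u n ^ 6 with hδ
  have hnδ : ∀ n, u n ≠ 0 → n * δ n = D * Real.log n / u n ^ 2 := fun n hn => by
    have : u n ^ 4 * (D * Real.log n / u n ^ 6) = D * Real.log n / u n ^ 2 := by field_simp
    rwa [hu4 n] at this
  set bad₁ : ℕ → Set Ω := fun n =>
    {ω | 2 * (4 * (u n ^ 2 * Real.log n)) ≤ n * |empDF X n ω ξ - p|} with hbad₁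
  set bad₂ : ℕ → ℤ → Set Ω := fun n r =>
    {ω | 2 * (A * (u n * Real.log n))
      ≤ n * |empDF X n ω (ξ + r * δ n) - empDF X n ω ξ - (F (ξ + r * δ n) - F ξ)|} with hbad₂
  have hexp_log : ∀ n : ℕ, 1 ≤ n → ∀ k : ℕ, Real.exp (-(k * Real.log n)) = ((n : ℝ) ^ k)⁻¹ := by
    intro n hn k
    rw [Real.exp_neg, Real.exp_nat_mul, Real.exp_log (by positivity)]
  have hgrid : ∀ᶠ n : ℕ in atTop, ∀ r : ℤ, |r| ≤ n →
      |ξ + r * δ n - ξ| ≤ ρ ∧ |ξ + r * δ n - ξ| ≤ D * Real.log n / u n ^ 2 := by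
    filter_upwards [eventually_ge_atTop 1, hutop.eventually_ge_atTop 1,
      hutop.eventually_ge_atTop (4 * D / ρ)] with n hn hu1 huρ r hr
    have hv : 0 ≤ Real.log n := Real.log_natCast_nonneg n
    have hδ0 : 0 ≤ δ n := by simp only [hδ]; positivity
    have h1 : |ξ + r * δ n - ξ| ≤ D * Real.log n / u n ^ 2 := by
      rw [add_sub_cancel_left, abs_mul, abs_of_nonneg hδ0, ← hnδ n (by positivity)]
      gcongr
      exact_mod_cast hr
    refine ⟨h1.trans ?_, h1⟩
    rw [div_le_iff₀ hρ] at huρ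
    rw [div_le_iff₀ (by positivity)]
    nlinarith [mul_le_mul_of_nonneg_left (hvu n) hD0.le,
      mul_le_mul_of_nonneg_right huρ (by positivity : 0 ≤ u n)]
  have hprob₁ : ∀ᶠ n : ℕ in atTop, μ.real (bad₁ n) ≤ 4 * Real.exp (2 * C) * ((n : ℝ) ^ 2)⁻¹ := by
    filter_upwards [eventually_ge_atTop 1, hutop.eventually_ge_atTop 1] with n hn hu1
    have h := hbern n hn (Iic ξ) (F ξ) measurableSet_Iic (fun i hi => (hF' i hi ξ).symm)
      (1 / (2 * u n ^ 2)) (by positivity)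
      (by
        change 1 / (2 * u n ^ 2) * (2 * u n) ≤ 1
        rw [div_mul_eq_mul_div, div_le_one (by positivity)]
        nlinarith) (4 * (u n ^ 2 * Real.log n))
    simp only [sum_centeredInd_Iic hn, abs_mul, Nat.abs_cast, hFp] at h
    refine h.trans ?_
    rw [← hexp_log n hn 2, mul_assoc 4 (Real.exp (2 * C)), ← Real.exp_add]
    have h1 : -(1 / (2 * u n ^ 2)) * (4 * (u n ^ 2 * Real.log n)) = -(2 * Real.log n) := by
      field_simp
      ring
    have h2 : (1 / (2 * u n ^ 2)) ^ 2 * n * p = p / 4 := by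
      rw [← hu4 n]
      field_simp
      ring
    have h3 : C * (p / 4 + 1) ≤ C * 2 := by
      gcongr
      linarith [hp.2]
    rw [h1, h2]
    refine mul_le_mul_of_nonneg_left (Real.exp_le_exp.2 ?_) (by norm_num)
    push_cast
    linarith
  have hprob₂ : ∀ᶠ n : ℕ in atTop, ∀ r : ℤ, |r| ≤ n →
      μ.real (bad₂ n r) ≤ 4 * Real.exp C * ((n : ℝ) ^ 4)⁻¹ := by
    filter_upwards [eventually_ge_atTop 1, hutop.eventually_ge_atTop 1, hgrid]
      with n hn hu1 hgr r hr
    have hv : 0 ≤ Real.log n := Real.log_natCast_nonneg n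
    have hQ : |F (ξ + r * δ n) - F ξ| ≤ L * (D * Real.log n / u n ^ 2) :=
      (hlip _ (hgr r hr).1).trans (mul_le_mul_of_nonneg_left (hgr r hr).2 hL0)
    have h := measureReal_empDF_increment_ge_le hX hF' hn hC
      (t := 1 / (2 * u n)) (ε := A * (u n * Real.log n))
      (fun B q hB hq => hbern n hn B q hB hq _ (by positivity)
        (by
          change 1 / (2 * u n) * (2 * u n) ≤ 1
          rw [one_div_mul_cancel (by positivity)]) _) hQ
    refine h.trans ?_
    rw [← hexp_log n hn 4, mul_assoc 4 (Real.exp C), ← Real.exp_add]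
    have h1 : -(1 / (2 * u n)) * (A * (u n * Real.log n))
        + C * ((1 / (2 * u n)) ^ 2 * n * (L * (D * Real.log n / u n ^ 2)) + 1)
        = C - 4 * Real.log n := by
      have h2 : (1 / (2 * u n)) ^ 2 * n = u n ^ 2 / 4 := by
        rw [← hu4 n]
        field_simp
        ring
      rw [h2, hA]
      field_simp
      ring
    rw [h1]
    gcongr
    push_cast
    linarith
  have hprob : ∀ᶠ n : ℕ in atTop,
      μ.real (bad₁ n ∪ ⋃ r ∈ Finset.Icc (-(n : ℤ)) n, bad₂ n r)
        ≤ (4 * Real.exp (2 * C) + 12 * Real.exp C) * ((n : ℝ) ^ 2)⁻¹ := by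
    filter_upwards [hprob₁, hprob₂, eventually_ge_atTop 1] with n h1 h2 hn
    have hn' : (1 : ℝ) ≤ n := by exact_mod_cast hn
    refine (measureReal_union_le _ _).trans ?_
    have h3 : μ.real (⋃ r ∈ Finset.Icc (-(n : ℤ)) n, bad₂ n r)
        ≤ ∑ r ∈ Finset.Icc (-(n : ℤ)) n, μ.real (bad₂ n r) :=
      measureReal_biUnion_finset_le _ _
    have h4 : ∑ r ∈ Finset.Icc (-(n : ℤ)) n, μ.real (bad₂ n r)
        ≤ (2 * n + 1) * (4 * Real.exp C * ((n : ℝ) ^ 4)⁻¹) := by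
      refine (Finset.sum_le_card_nsmul _ _ _ fun r hr => h2 r ?_).trans_eq ?_
      · rw [Finset.mem_Icc] at hr
        exact abs_le.2 hr
      · rw [Int.card_Icc, nsmul_eq_mul]
        congr 1
        have : ((n : ℤ) + 1 - -(n : ℤ)).toNat = 2 * n + 1 := by omega
        rw [this]
        push_cast
        ring
    have h5 : (2 * n + 1) * (4 * Real.exp C * ((n : ℝ) ^ 4)⁻¹)
        ≤ 12 * Real.exp C * ((n : ℝ) ^ 2)⁻¹ := by
      have h6 : (2 * n + 1) * ((n : ℝ) ^ 4)⁻¹ ≤ 3 * ((n : ℝ) ^ 2)⁻¹ := by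
        rw [← div_eq_mul_inv, ← div_eq_mul_inv, div_le_div_iff₀ (by positivity) (by positivity)]
        have h7 : (2 * n + 1 : ℝ) ≤ 3 * n ^ 2 := by nlinarith
        calc (2 * (n : ℝ) + 1) * (n : ℝ) ^ 2 ≤ 3 * (n : ℝ) ^ 2 * (n : ℝ) ^ 2 := by gcongr
          _ = 3 * (n : ℝ) ^ 4 := by ring
      have := mul_le_mul_of_nonneg_left h6 (by positivity : 0 ≤ 4 * Real.exp C)
      linarith
    linarith
  filter_upwards [ae_eventually_notMem_of_measureReal_le hprob] with ω hω
  refine .of_bound (E / b + D) ?_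
  filter_upwards [hω, hgrid, eventually_ge_atTop 4, hutop.eventually_ge_atTop 1,
    hutop.eventually_ge_atTop (4 * E / (b * D))] with n hωn hgr hn hu1 huE
  have hn1 : 1 ≤ n := by omega
  have hn4 : (4 : ℝ) ≤ n := by exact_mod_cast hn
  have hv : 0 < Real.log n := Real.log_pos (by linarith)
  have hu0 : 0 < u n := by linarith
  have hδ0 : 0 < δ n := by simp only [hδ]; positivity
  simp only [mem_union, mem_iUnion, not_or, not_exists, Finset.mem_Icc, hbad₁, hbad₂,
    mem_ofPred_eq, not_le] at hωn
  obtain ⟨hω₁, hω₂⟩ := hωn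
  have hrate : (n : ℝ) ^ (-(3 : ℝ) / 4) * Real.log n = Real.log n / u n ^ 3 := by
    have : (n : ℝ) ^ (-(3 : ℝ) / 4) = (u n ^ 3)⁻¹ := by
      rw [hu, ← Real.rpow_natCast, ← Real.rpow_mul (by positivity), ← Real.rpow_neg (by positivity)]
      norm_num
    rw [this, inv_mul_eq_div]
  set v := Real.log n with hvdef
  have hcenter : |empDF X n ω ξ - p| ≤ 8 * v / u n ^ 2 := by
    rw [le_div_iff₀ (by positivity)]
    rw [← hu4 n] at hω₁
    nlinarith [sq_pos_of_pos hu0]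
  have hlocal : ∀ r : ℤ, |r| ≤ n →
      |empDF X n ω (ξ + r * δ n) - empDF X n ω ξ - b * (r * δ n)| ≤ E * v / u n ^ 3 := by
    intro r hr
    have h1 : |empDF X n ω (ξ + r * δ n) - empDF X n ω ξ - (F (ξ + r * δ n) - F ξ)|
        ≤ 2 * A * v / u n ^ 3 := by
      have h := hω₂ r (abs_le.1 hr)
      rw [← hu4 n] at h
      rw [le_div_iff₀ (by positivity)]
      refine le_of_mul_le_mul_left ?_ hu0
      linarith
    have h2 := htaylor _ (hgr r hr).1
    have h3 : M * (ξ + r * δ n - ξ) ^ 2 ≤ 4 * M * D ^ 2 * v / u n ^ 3 := by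
      have h4 : (ξ + r * δ n - ξ) ^ 2 ≤ (D * v / u n ^ 2) ^ 2 := by
        rw [← sq_abs]
        have := (hgr r hr).2
        gcongr
      calc M * (ξ + r * δ n - ξ) ^ 2 ≤ M * (D * v / u n ^ 2) ^ 2 := by gcongr
        _ = M * D ^ 2 * v * v / u n ^ 4 := by field_simp
        _ ≤ M * D ^ 2 * v * (4 * u n) / u n ^ 4 := by
            gcongr
            exact hvu n
        _ = 4 * M * D ^ 2 * v / u n ^ 3 := by field_simp
    rw [add_sub_cancel_left] at h2 h3
    have h5 := abs_add_le
      (empDF X n ω (ξ + r * δ n) - empDF X n ω ξ - (F (ξ + r * δ n) - F ξ))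
      (F (ξ + r * δ n) - F ξ - b * (r * δ n))
    rw [sub_add_sub_cancel] at h5
    have h6 : E * v / u n ^ 3 = 2 * A * v / u n ^ 3 + 4 * M * D ^ 2 * v / u n ^ 3 := by
      rw [hE]
      ring
    linarith
  have hN : |empDF X n ω ξ - p| / b + E * v / u n ^ 3 / b + δ n ≤ n * δ n := by
    have h1 : |empDF X n ω ξ - p| / b ≤ n * δ n / 4 := by
      rw [hnδ n hu0.ne', div_le_iff₀ hb]
      refine hcenter.trans_eq ?_
      rw [hD]
      field_simp
      ring
    have h2 : E * v / u n ^ 3 / b ≤ n * δ n / 4 := by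
      rw [div_le_iff₀ (by positivity)] at huE
      calc E * v / u n ^ 3 / b = 4 * E * (v / (4 * u n ^ 3 * b)) := by field_simp
        _ ≤ u n * (b * D) * (v / (4 * u n ^ 3 * b)) := by gcongr
        _ = n * δ n / 4 := by
            rw [hnδ n hu0.ne', ← hvdef]
            field_simp
    have h3 : 4 * δ n ≤ n * δ n := by gcongr
    linarith
  obtain ⟨x₀, hx₀⟩ := exists_empDF_eq_zero (X := X) n ω
  obtain ⟨x₁, hx₁⟩ := exists_empDF_eq_one (X := X) hn1 ω
  have hmain := abs_sub_linearized_root_le hb hδ0 (by positivity : 0 ≤ E * v / u n ^ 3)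
    (fun y hy => lt_of_lt_sInf_superlevel (monotone_empDF n ω) (hx₀.trans_lt hp.1) hy)
    (fun y hy => le_of_sInf_superlevel_lt (monotone_empDF n ω) (hp.2.le.trans_eq hx₁.symm) hy)
    hlocal hN
  rw [hrate, Real.norm_eq_abs, Real.norm_of_nonneg (by positivity)]
  refine hmain.trans ?_
  have hδle : δ n ≤ D * v / u n ^ 3 := by
    simp only [hδ]
    gcongr
    norm_num
  have : (E / b + D) * (v / u n ^ 3) = E * v / u n ^ 3 / b + D * v / u n ^ 3 := by ring
  linarith
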